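/- arXiv:2002.10814 — 2 statements merged into one kernel-verified Lean document; each statement's English description precedes it below -/
import Mathlib

section
/- If P ⊑^{r*}_FT Q (or P ⊑*_FT Q) and both P and Q are stable, then I(P) = I(Q). -/
/-! ### The process algebra CCSP_t

The countably infinite set `A` of visible actions and the countably infinite set `V`
of variables are both taken to be `ℕ`. -/

/-- Actions: visible actions from `A = ℕ`, the hidden action `τ`,
and the time-out action `t`. -/
inductive Act : Type
  | act : ℕ → Act
  | tau : Act
  | timeout : Act

/-- CCSP_t expressions.  A recursive specification `S` is represented as a partial
function `ℕ → Option Expr`; its domain is the set `V_S` of bound variables, and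
`⟨X|S⟩` is written `Expr.fix X S`. -/
inductive Expr : Type
  | nil : Expr
  | pre : Act → Expr → Expr
  | choice : Expr → Expr → Expr
  | par : Set ℕ → Expr → Expr → Expr
  | abs : Set ℕ → Expr → Expr
  | ren : Set (ℕ × ℕ) → Expr → Expr
  | var : ℕ → Expr
  | fix : ℕ → (ℕ → Option Expr) → Expr

/-- `α.notIn S`: the action `α` is not a visible action belonging to `S ⊆ A`. -/
def Act.notIn (α : Act) (S : Set ℕ) : Prop := ∀ a : ℕ, α = Act.act a → a ∉ S

/-- Relational substitution: `Subst ρ E E'` holds iff `E'` is the result of replacing,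
in `E`, every free occurrence of each variable `Y` in the domain of `ρ` by the
expression `ρ Y` (occurrences bound by an inner recursion are not replaced). -/
inductive Subst : (ℕ → Option Expr) → Expr → Expr → Prop
  | nil {ρ} : Subst ρ .nil .nil
  | pre {ρ α E E'} : Subst ρ E E' → Subst ρ (.pre α E) (.pre α E')
  | choice {ρ E F E' F'} : Subst ρ E E' → Subst ρ F F' →
      Subst ρ (.choice E F) (.choice E' F')
  | par {ρ S E F E' F'} : Subst ρ E E' → Subst ρ F F' →
      Subst ρ (.par S E F) (.par S E' F')
  | abs {ρ I E E'} : Subst ρ E E' → Subst ρ (.abs I E) (.abs I E')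
  | ren {ρ R E E'} : Subst ρ E E' → Subst ρ (.ren R E) (.ren R E')
  | varNone {ρ Y} : ρ Y = none → Subst ρ (.var Y) (.var Y)
  | varSome {ρ Y F} : ρ Y = some F → Subst ρ (.var Y) F
  | fix {ρ Z} {T T' : ℕ → Option Expr} :
      (∀ Y, T Y = none ↔ T' Y = none) →
      (∀ Y E E', T Y = some E → T' Y = some E' →
          Subst (fun W => if (T W).isSome then none else ρ W) E E') →
      Subst ρ (.fix Z T) (.fix Z T')

/-- The substitution replacing each bound variable `Y` of `S` by `⟨Y|S⟩`. -/
def recmap (S : ℕ → Option Expr) : ℕ → Option Expr :=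
  fun Y => (S Y).map (fun _ => Expr.fix Y S)

/-- The structural operational (interleaving) semantics of CCSP_t. -/
inductive Step : Expr → Act → Expr → Prop
  | pre {α E} : Step (.pre α E) α E
  | choiceL {E F α E'} : Step E α E' → Step (.choice E F) α E'
  | choiceR {E F α F'} : Step F α F' → Step (.choice E F) α F'
  | renTau {R E E'} : Step E .tau E' → Step (.ren R E) .tau (.ren R E')
  | renTimeout {R E E'} : Step E .timeout E' →
      Step (.ren R E) .timeout (.ren R E')
  | renAct {R E E' a b} : Step E (.act a) E' → (a, b) ∈ R →
      Step (.ren R E) (.act b) (.ren R E')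
  | parL {S E F α E'} : Step E α E' → α.notIn S →
      Step (.par S E F) α (.par S E' F)
  | parR {S E F α F'} : Step F α F' → α.notIn S →
      Step (.par S E F) α (.par S E F')
  | parSync {S E F a E' F'} : Step E (.act a) E' → Step F (.act a) F' → a ∈ S →
      Step (.par S E F) (.act a) (.par S E' F')
  | absFree {I E α E'} : Step E α E' → α.notIn I →
      Step (.abs I E) α (.abs I E')
  | absHide {I E a E'} : Step E (.act a) E' → a ∈ I →
      Step (.abs I E) .tau (.abs I E')
  | fixUnfold {X S E E' α F} : S X = some E → Subst (recmap S) E E' →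
      Step E' α F → Step (.fix X S) α F

/-- Free occurrence of a variable in a CCSP_t expression. -/
inductive Free (x : ℕ) : Expr → Prop
  | pre {α E} : Free x E → Free x (.pre α E)
  | choiceL {E F} : Free x E → Free x (.choice E F)
  | choiceR {E F} : Free x F → Free x (.choice E F)
  | parL {S E F} : Free x E → Free x (.par S E F)
  | parR {S E F} : Free x F → Free x (.par S E F)
  | abs {I E} : Free x E → Free x (.abs I E)
  | ren {R E} : Free x E → Free x (.ren R E)
  | var : Free x (.var x)
  | fix {Z T Y E} : T Y = some E → Free x E → T x = none → Free x (.fix Z T)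

/-- An expression is closed if no variable occurs free in it. -/
def Closed (E : Expr) : Prop := ∀ x, ¬ Free x E

/-- Well-formedness: in every recursion `⟨X|S⟩` occurring in the expression the
variable `X` is bound by `S`, and every relational renaming occurring in it has
finite images `{b | (a,b) ∈ R}`. -/
inductive WF : Expr → Prop
  | nil : WF .nil
  | pre {α E} : WF E → WF (.pre α E)
  | choice {E F} : WF E → WF F → WF (.choice E F)
  | par {S E F} : WF E → WF F → WF (.par S E F)
  | abs {I E} : WF E → WF (.abs I E)
  | ren {R E} : (∀ a : ℕ, {b | (a, b) ∈ R}.Finite) → WF E → WF (.ren R E)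
  | var {X} : WF (.var X)
  | fix {X T} : (T X).isSome → (∀ Y E, T Y = some E → WF E) → WF (.fix X T)

/-- `ℙ`: a process is a closed well-formed CCSP_t expression. -/
def IsProcess (E : Expr) : Prop := Closed E ∧ WF E

/-- A process is stable if it has no outgoing τ-transitions. -/
def stable (P : Expr) : Prop := ¬ ∃ P', Step P .tau P'

/-- The set `I(P)` of initial visible actions of a process. -/
def initials (P : Expr) : Set ℕ := {a | ∃ P', Step P (.act a) P'}

/-! ### Partial failure traces -/

/-- An element of a partial failure trace: a visible action `a ∈ A`
or a refusal set `X ⊆ A`. -/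
abbrev Elt : Type := Sum ℕ (Set ℕ)

/-- Partial failure traces: sequences over `A ∪ 𝒫(A)`; the final tag `⊤` is
left implicit. -/
abbrev PFT : Type := List Elt

/-- The set of partial failure traces of a process (Table 3). -/
inductive fft : Expr → PFT → Prop
  | top {P} : fft P []
  | act {P Q a ρ} : Step P (.act a) Q → fft Q ρ → fft P (Sum.inl a :: ρ)
  | tau {P Q ρ} : Step P .tau Q → fft Q ρ → fft P ρ
  | refusal {P X ρ} : (∀ a ∈ X, a ∉ initials P) → stable P → fft P ρ →
      fft P (Sum.inr X :: ρ)
  | timeoutRef {P Q X ρ} : (∀ a ∈ X, a ∉ initials P) → stable P →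
      Step P .timeout Q → fft Q (Sum.inr X :: ρ) → fft P (Sum.inr X :: ρ)
  | timeoutAct {P Q X a ρ} : (∀ a' ∈ X, a' ∉ initials P) → stable P →
      Step P .timeout Q → fft Q (Sum.inl a :: ρ) → a ∈ X →
      fft P (Sum.inr X :: Sum.inl a :: ρ)

def fftSet (P : Expr) : Set PFT := {σ | fft P σ}

/-! ### Rooted partial failure traces -/

/-- Rooted partial failure traces: ordinary partial failure traces, traces
`t·Xσ` starting with a time-out transition (represented as `rooted X σ`,
standing for the trace `Xσ` preceded by `t`), and the two tags `st`
and `post-st`. -/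
inductive RPFT : Type
  | plain : PFT → RPFT
  | rooted : Set ℕ → PFT → RPFT
  | st : RPFT
  | postst : RPFT

/-- The set `rfft(P)` of rooted partial failure traces of a process. -/
def rfftSet (P : Expr) : Set RPFT :=
  {r |
    (∃ σ, r = RPFT.plain σ ∧ fft P σ) ∨
    (r = RPFT.st ∧ stable P) ∨
    (∃ X σ, r = RPFT.rooted X σ ∧ stable P ∧ (∀ a ∈ X, a ∉ initials P) ∧
      ∃ P', Step P .timeout P' ∧ fft P' (Sum.inr X :: σ)) ∨
    (r = RPFT.postst ∧ (∃ P', Step P .tau P') ∧ fft P [Sum.inr (∅ : Set ℕ)])}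

/-- A stable process with a partial failure trace starting with `a` has `a` as an initial. -/
theorem mem_initials_of_fft {P : Expr} {a : ℕ} {ρ : PFT} (sP : stable P)
    (h : fft P (Sum.inl a :: ρ)) : a ∈ initials P := by
  cases h with
  | act hstep _ => exact ⟨_, hstep⟩
  | tau hstep _ => exact absurd ⟨_, hstep⟩ sP

/-- A stable process with a partial failure trace starting with `X` has no initial in `X`. -/
theorem notMem_initials_of_fft {P : Expr} {X : Set ℕ} {ρ : PFT} (sP : stable P)
    (h : fft P (Sum.inr X :: ρ)) : ∀ a ∈ X, a ∉ initials P := by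
  cases h with
  | tau hstep _ => exact absurd ⟨_, hstep⟩ sP
  | refusal hX _ _ => exact hX
  | timeoutRef hX _ _ _ => exact hX
  | timeoutAct hX _ _ _ _ => exact hX

theorem plain_mem_rfftSet {P : Expr} {σ : PFT} : RPFT.plain σ ∈ rfftSet P ↔ fft P σ := by
  simp [rfftSet]

/-- If `P ⊑^{r*}_FT Q` (or `P ⊑*_FT Q`) and both `P` and `Q`
are stable, then `I(P) = I(Q)`. -/
theorem initials_equal (P Q : Expr) (hP : IsProcess P) (hQ : IsProcess Q)
    (h : rfftSet Q ⊆ rfftSet P ∨ fftSet Q ⊆ fftSet P)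
    (sP : stable P) (sQ : stable Q) :
    initials P = initials Q := by
  have hsub : ∀ σ, fft Q σ → fft P σ := by
    intro σ hσ
    rcases h with h | h
    · exact plain_mem_rfftSet.mp (h (plain_mem_rfftSet.mpr hσ))
    · exact h hσ
  apply Set.Subset.antisymm
  · intro a ha
    by_contra hna
    have href : fft Q [Sum.inr (initials Q)ᶜ] := .refusal (fun _ hb => hb) sQ .top
    exact notMem_initials_of_fft sP (hsub _ href) a hna ha
  · rintro a ⟨Q', hstep⟩
    exact mem_initials_of_fft sP (hsub _ (.act hstep .top))
end

section
/- The rooted partial failure trace preorder ⊑^{r*}_FT is a precongruence for the operators of CCSP_t: for every unary recursion-free CCSP_t-context C, if rfft(P) ⊇ rfft(Q) then rfft(C[P]) ⊇ rfft(C[Q]). -/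
/-! ### Unary recursion-free CCSP_t-contexts -/

/-- Unary recursion-free CCSP_t-contexts: expressions built from a hole and the
operators of CCSP_t, with expressions as further arguments. -/
inductive Ctx : Type
  | hole : Ctx
  | pre : Act → Ctx → Ctx
  | choiceL : Ctx → Expr → Ctx
  | choiceR : Expr → Ctx → Ctx
  | parL : Set ℕ → Ctx → Expr → Ctx
  | parR : Set ℕ → Expr → Ctx → Ctx
  | abs : Set ℕ → Ctx → Ctx
  | ren : Set (ℕ × ℕ) → Ctx → Ctx

/-- `C.fill P = C[P]`: the process obtained by filling the hole with `P`. -/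
def Ctx.fill : Ctx → Expr → Expr
  | .hole, P => P
  | .pre α C, P => .pre α (C.fill P)
  | .choiceL C Q, P => .choice (C.fill P) Q
  | .choiceR Q C, P => .choice Q (C.fill P)
  | .parL S C Q, P => .par S (C.fill P) Q
  | .parR S Q C, P => .par S Q (C.fill P)
  | .abs I C, P => .abs I (C.fill P)
  | .ren R C, P => .ren R (C.fill P)

/-- The further arguments of the context are closed processes, and all renaming
operators in the context have finite images. -/
inductive Ctx.OK : Ctx → Prop
  | hole : Ctx.OK .hole
  | pre {α C} : Ctx.OK C → Ctx.OK (.pre α C)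
  | choiceL {C Q} : Ctx.OK C → IsProcess Q → Ctx.OK (.choiceL C Q)
  | choiceR {Q C} : IsProcess Q → Ctx.OK C → Ctx.OK (.choiceR Q C)
  | parL {S C Q} : Ctx.OK C → IsProcess Q → Ctx.OK (.parL S C Q)
  | parR {S Q C} : IsProcess Q → Ctx.OK C → Ctx.OK (.parR S Q C)
  | abs {I C} : Ctx.OK C → Ctx.OK (.abs I C)
  | ren {R C} : (∀ a : ℕ, {b | (a, b) ∈ R}.Finite) → Ctx.OK C → Ctx.OK (.ren R C)

/-! ### Refusals and inversion of partial failure traces -/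

/-- `P` is stable and offers no action from `X`. -/
def Refuses (P : Expr) (X : Set ℕ) : Prop := stable P ∧ ∀ a ∈ X, a ∉ initials P

theorem Refuses.not_fft_act {P : Expr} {X : Set ℕ} {a : ℕ} {ρ : PFT} (hP : Refuses P X)
    (ha : a ∈ X) : ¬ fft P (Sum.inl a :: ρ) := by
  intro h
  cases h with
  | act h _ => exact hP.2 a ha ⟨_, h⟩
  | tau h _ => exact hP.1 ⟨_, h⟩

theorem fft_refusal_singleton {P : Expr} {X : Set ℕ} (hP : Refuses P X) :
    fft P [Sum.inr X] :=
  .refusal hP.2 hP.1 .top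

theorem refuses_of_fft {P : Expr} {X : Set ℕ} {ρ : PFT} (hP : stable P)
    (h : fft P (Sum.inr X :: ρ)) : Refuses P X := by
  cases h with
  | tau h _ => exact absurd ⟨_, h⟩ hP
  | refusal h _ _ => exact ⟨hP, h⟩
  | timeoutRef h _ _ _ => exact ⟨hP, h⟩
  | timeoutAct h _ _ _ _ => exact ⟨hP, h⟩

theorem initials_of_fft {P : Expr} {a : ℕ} {ρ : PFT} (hP : stable P)
    (h : fft P (Sum.inl a :: ρ)) : a ∈ initials P := by
  cases h with
  | act h _ => exact ⟨_, h⟩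
  | tau h _ => exact absurd ⟨_, h⟩ hP

/-- A stable process engaging in an action it refused before must have timed out. -/
theorem exists_timeout_of_fft {P : Expr} {X : Set ℕ} {a : ℕ} {ρ : PFT} (hP : stable P)
    (ha : a ∈ X) (h : fft P (Sum.inr X :: Sum.inl a :: ρ)) :
    ∃ P', Step P .timeout P' ∧
      (fft P' (Sum.inr X :: Sum.inl a :: ρ) ∨ fft P' (Sum.inl a :: ρ)) := by
  have hX := refuses_of_fft hP h
  cases h with
  | tau h _ => exact absurd ⟨_, h⟩ hP
  | refusal _ _ h => exact absurd h (hX.not_fft_act ha)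
  | timeoutRef _ _ h h' => exact ⟨_, h, .inl h'⟩
  | timeoutAct _ _ h h' _ => exact ⟨_, h, .inr h'⟩

theorem fft_empty_of_fft {P : Expr} {X : Set ℕ} {ρ : PFT} (h : fft P (Sum.inr X :: ρ)) :
    fft P [Sum.inr ∅] := by
  generalize hσ : (Sum.inr X :: ρ : PFT) = σ at h
  induction h with
  | top => simp at hσ
  | act => simp at hσ
  | tau h _ ih => exact .tau h (ih hσ)
  | refusal _ h _ => exact .refusal (by simp) h .top
  | timeoutRef _ h => exact .refusal (by simp) h .top
  | timeoutAct _ h => exact .refusal (by simp) h .top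

/-! ### The rooted preorder -/

/-- `RootedLE Q P` spells out `rfft(Q) ⊆ rfft(P)`. -/
structure RootedLE (Q P : Expr) : Prop where
  fft : ∀ {σ}, fft Q σ → fft P σ
  stable : stable Q → stable P
  timeout : ∀ {Q' X σ}, Refuses Q X → Step Q .timeout Q' → _root_.fft Q' (Sum.inr X :: σ) →
    ∃ P', Step P .timeout P' ∧ _root_.fft P' (Sum.inr X :: σ)
  tau : (∃ Q', Step Q .tau Q') → _root_.fft Q [Sum.inr ∅] → ∃ P', Step P .tau P'

theorem RootedLE.refuses {Q P : Expr} {X : Set ℕ} (h : RootedLE Q P) (hQ : Refuses Q X) :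
    Refuses P X :=
  refuses_of_fft (h.stable hQ.1) (h.fft (fft_refusal_singleton hQ))

theorem rfftSet_subset_iff {Q P : Expr} : rfftSet Q ⊆ rfftSet P ↔ RootedLE Q P := by
  constructor
  · intro h
    refine ⟨fun {σ} hσ => ?_, fun hQ => ?_, fun {Q' X σ} hX hs hσ => ?_, fun ht h0 => ?_⟩
    · have := @h (.plain σ) (.inl ⟨σ, rfl, hσ⟩)
      simpa [rfftSet] using this
    · have := @h .st (.inr (.inl ⟨rfl, hQ⟩))
      simpa [rfftSet] using this
    · have := @h (.rooted X σ) (.inr (.inr (.inl ⟨X, σ, rfl, hX.1, hX.2, Q', hs, hσ⟩)))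
      obtain ⟨_, h, _⟩ | ⟨h, _⟩ | ⟨X', σ', h, _, _, h'⟩ | ⟨h, _⟩ := this
      · simp at h
      · simp at h
      · cases h
        exact h'
      · simp at h
    · have := @h .postst (.inr (.inr (.inr ⟨rfl, ht, h0⟩)))
      obtain ⟨_, h, _⟩ | ⟨h, _⟩ | ⟨_, _, h, _⟩ | ⟨_, h, _⟩ := this
      · simp at h
      · simp at h
      · simp at h
      · exact h
  · rintro h r (⟨σ, rfl, hσ⟩ | ⟨rfl, hs⟩ | ⟨X, σ, rfl, hs, hX, Q', ht, hσ⟩ | ⟨rfl, ht, h0⟩)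
    · exact .inl ⟨σ, rfl, h.fft hσ⟩
    · exact .inr (.inl ⟨rfl, h.stable hs⟩)
    · have hP := h.refuses ⟨hs, hX⟩
      exact .inr (.inr (.inl ⟨X, σ, rfl, hP.1, hP.2, h.timeout ⟨hs, hX⟩ ht hσ⟩))
    · exact .inr (.inr (.inr ⟨rfl, h.tau ht h0, h.fft h0⟩))

/-! ### Static operators -/

/-- A family of unary static operators, indexed by the states `κ` of the surrounding context.
The context may move on its own (`own`), let a `τ` or time-out of its argument pass, or
react to a visible action of its argument (`sync`). -/
structure StaticOp (κ : Type) where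
  op : κ → Expr → Expr
  own : κ → Act → κ → Prop
  sync : κ → ℕ → Act → κ → Prop
  not_sync_timeout : ∀ {k a k'}, ¬ sync k a .timeout k'
  step_iff : ∀ {k E β F}, Step (op k E) β F ↔
    (β = .tau ∧ ∃ E', Step E .tau E' ∧ F = op k E') ∨
    (β = .timeout ∧ ∃ E', Step E .timeout E' ∧ F = op k E') ∨
    (∃ k', own k β k' ∧ F = op k' E) ∨
    (∃ a k' E', sync k a β k' ∧ Step E (.act a) E' ∧ F = op k' E')

namespace StaticOp

variable {κ : Type} (O : StaticOp κ)

/-- The context on its own can neither do a `τ` nor an action from `X`. -/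
def Quiet (k : κ) (X : Set ℕ) : Prop :=
  (∀ l, ¬ O.own k .tau l) ∧ ∀ a ∈ X, ∀ l, ¬ O.own k (.act a) l

/-- The actions the argument must refuse for the whole to be stable and refuse `X`. -/
def back (k : κ) (X : Set ℕ) : Set ℕ :=
  {a | ∃ k', O.sync k a .tau k' ∨ ∃ b ∈ X, O.sync k a (.act b) k'}

theorem step_tau {k E E'} (h : Step E .tau E') : Step (O.op k E) .tau (O.op k E') :=
  O.step_iff.2 (.inl ⟨rfl, _, h, rfl⟩)

theorem step_timeout {k E E'} (h : Step E .timeout E') :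
    Step (O.op k E) .timeout (O.op k E') :=
  O.step_iff.2 (.inr (.inl ⟨rfl, _, h, rfl⟩))

theorem step_own {k k' β E} (h : O.own k β k') : Step (O.op k E) β (O.op k' E) :=
  O.step_iff.2 (.inr (.inr (.inl ⟨_, h, rfl⟩)))

theorem step_sync {k k' a β E E'} (h : O.sync k a β k') (hE : Step E (.act a) E') :
    Step (O.op k E) β (O.op k' E') :=
  O.step_iff.2 (.inr (.inr (.inr ⟨_, _, _, h, hE, rfl⟩)))

theorem refuses_op_iff {k : κ} {E : Expr} {X : Set ℕ} :
    Refuses (O.op k E) X ↔ O.Quiet k X ∧ Refuses E (O.back k X) := by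
  constructor
  · rintro ⟨hs, hX⟩
    refine ⟨⟨fun k' h => hs ⟨_, O.step_own h⟩, fun a ha k' h => hX a ha ⟨_, O.step_own h⟩⟩,
      fun ⟨_, h⟩ => hs ⟨_, O.step_tau h⟩, ?_⟩
    rintro a ⟨k', h | ⟨b, hb, h⟩⟩ ⟨E', hE⟩
    · exact hs ⟨_, O.step_sync h hE⟩
    · exact hX b hb ⟨_, O.step_sync h hE⟩
  · rintro ⟨hq, hs, hX⟩
    refine ⟨?_, ?_⟩
    · rintro ⟨F, h⟩
      obtain ⟨_, E', h, _⟩ | ⟨h, _⟩ | ⟨k', h, _⟩ | ⟨a, k', E', h, hE, _⟩ := O.step_iff.1 h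
      · exact hs ⟨_, h⟩
      · cases h
      · exact hq.1 _ h
      · exact hX a ⟨k', .inl h⟩ ⟨_, hE⟩
    · rintro b hb ⟨F, h⟩
      obtain ⟨h, _⟩ | ⟨h, _⟩ | ⟨k', h, _⟩ | ⟨a, k', E', h, hE, _⟩ := O.step_iff.1 h
      · cases h
      · cases h
      · exact hq.2 b hb _ h
      · exact hX a ⟨k', .inr ⟨b, hb, h⟩⟩ ⟨_, hE⟩

variable {O}

theorem fft_op_of_act {k : κ} {a : ℕ} {ν σ : PFT}
    (h : ∀ P P', Step P (.act a) P' → fft P' ν → fft (O.op k P) σ) {P : Expr}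
    (hP : fft P (Sum.inl a :: ν)) : fft (O.op k P) σ := by
  generalize hτ : (Sum.inl a :: ν : PFT) = τ at hP
  induction hP with
  | top => simp at hτ
  | act hs hρ =>
    cases hτ
    exact h _ _ hs hρ
  | tau hs _ ih => exact .tau (O.step_tau hs) (ih hτ)
  | refusal => simp at hτ
  | timeoutRef => simp at hτ
  | timeoutAct => simp at hτ

theorem fft_op_of_refusal {k : κ} {X : Set ℕ} {ν σ : PFT} (hk : O.Quiet k X)
    (href : ∀ P, Refuses P (O.back k X) → fft P ν → fft (O.op k P) (Sum.inr X :: σ))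
    (hact : ∀ P P' a ν', ν = Sum.inl a :: ν' → a ∈ O.back k X → Refuses P (O.back k X) →
      Step P .timeout P' → fft P' ν → fft (O.op k P) (Sum.inr X :: σ))
    {P : Expr} (hP : fft P (Sum.inr (O.back k X) :: ν)) :
    fft (O.op k P) (Sum.inr X :: σ) := by
  generalize hτ : (Sum.inr (O.back k X) :: ν : PFT) = τ at hP
  induction hP with
  | top => simp at hτ
  | act => simp at hτ
  | tau hs _ ih => exact .tau (O.step_tau hs) (ih hτ)
  | refusal hX hs hρ =>
    cases hτ
    exact href _ ⟨hs, hX⟩ hρ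
  | timeoutRef hX hs ht _ ih =>
    cases hτ
    have h := O.refuses_op_iff.2 ⟨hk, hs, hX⟩
    exact .timeoutRef h.2 h.1 (O.step_timeout ht) (ih rfl)
  | timeoutAct hX hs ht hρ ha =>
    cases hτ
    exact hact _ _ _ _ rfl ha ⟨hs, hX⟩ ht hρ

variable (O) in
/-- The shape of a trace `ν` of the argument explaining a trace `σ` of `O.op k`:
as long as the context is quiet, the first element of `σ` stems from the argument. -/
def Guarded (k : κ) (σ ν : PFT) : Prop :=
  ∀ X, O.Quiet k X →
    (∀ σ', σ = Sum.inr X :: σ' → (∃ ν', ν = Sum.inr (O.back k X) :: ν') ∨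
      ∃ a ∈ O.back k X, ∃ ν', ν = Sum.inl a :: ν') ∧
    (∀ a ∈ X, ∀ σ', σ = Sum.inl a :: σ' → ∃ b ∈ O.back k X, ∃ ν', ν = Sum.inl b :: ν')

theorem guarded_refusal {k : κ} {X : Set ℕ} {σ ν : PFT} :
    O.Guarded k (Sum.inr X :: σ) (Sum.inr (O.back k X) :: ν) := by
  intro Y _
  refine ⟨fun σ' h => ?_, by simp⟩
  cases h
  exact .inl ⟨_, rfl⟩

/-- If a trace `ν` of a process refusing `O.back k X` explains how the whole, possibly after
a time-out of the context, continues, it can be prefixed by that refusal. -/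
theorem fft_op_cons_of_refuses {k : κ} {X : Set ℕ} {ν σ : PFT} {Q : Expr}
    (hk : O.Quiet k X) (hQ : Refuses Q (O.back k X)) (hν : fft Q ν)
    (h : ∀ P, Refuses (O.op k P) X → fft P ν → fft (O.op k P) (Sum.inr X :: σ)) {P : Expr}
    (hP : fft P (Sum.inr (O.back k X) :: ν)) : fft (O.op k P) (Sum.inr X :: σ) := by
  refine fft_op_of_refusal hk (fun P hX hP => h P (O.refuses_op_iff.2 ⟨hk, hX⟩) hP) ?_ hP
  rintro P P' a ν' rfl ha - - -
  exact absurd hν (hQ.not_fft_act ha)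

/-- Dually, `ν` may start with a refused action that becomes available by a time-out. -/
theorem fft_op_cons_of_timeout {k : κ} {X : Set ℕ} {a : ℕ} {ν σ : PFT}
    (hk : O.Quiet k X) (ha : a ∈ O.back k X)
    (h : ∀ P P', Refuses (O.op k P) X → Step P .timeout P' → fft P' (Sum.inl a :: ν) →
      fft (O.op k P) (Sum.inr X :: σ)) {P : Expr}
    (hP : fft P (Sum.inr (O.back k X) :: Sum.inl a :: ν)) :
    fft (O.op k P) (Sum.inr X :: σ) :=
  fft_op_of_refusal hk (fun _ hX hP => absurd hP (hX.not_fft_act ha))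
    (fun P P' _ _ _ _ hX ht hP => h P P' (O.refuses_op_iff.2 ⟨hk, hX⟩) ht hP) hP

/-- Each trace `σ` of `O.op k Q` is explained by a trace `ν` of `Q`: any process having the
trace `ν` will give rise to `σ`. -/
theorem exists_fft {k : κ} {Q : Expr} {σ : PFT} (hσ : fft (O.op k Q) σ) :
    ∃ ν, fft Q ν ∧ (∀ P, fft P ν → fft (O.op k P) σ) ∧ O.Guarded k σ ν := by
  generalize hE : O.op k Q = E at hσ
  induction hσ generalizing k Q with
  | top => exact ⟨[], .top, fun _ _ => .top, fun X _ => by simp⟩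
  | @act _ _ b _ hs _ ih =>
    subst hE
    obtain ⟨h, _⟩ | ⟨h, _⟩ | ⟨k', h, rfl⟩ | ⟨a, k', E', h, hE, rfl⟩ := O.step_iff.1 hs
    · cases h
    · cases h
    · obtain ⟨ν, hν, hD, -⟩ := ih rfl
      refine ⟨ν, hν, fun P hP => .act (O.step_own h) (hD P hP), fun X hX => ⟨by simp, ?_⟩⟩
      intro a ha σ' heq
      cases heq
      exact absurd h (hX.2 _ ha _)
    · obtain ⟨ν, hν, hD, -⟩ := ih rfl
      refine ⟨_, .act hE hν, fun P hP => fft_op_of_act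
        (fun P P' hs hP => .act (O.step_sync h hs) (hD P' hP)) hP, fun X hX => ⟨by simp, ?_⟩⟩
      intro b' hb σ' heq
      cases heq
      exact ⟨a, ⟨k', .inr ⟨b, hb, h⟩⟩, ν, rfl⟩
  | tau hs _ ih =>
    subst hE
    obtain ⟨_, E', h, rfl⟩ | ⟨h, _⟩ | ⟨k', h, rfl⟩ | ⟨a, k', E', h, hE, rfl⟩ := O.step_iff.1 hs
    · obtain ⟨ν, hν, hD, hG⟩ := ih rfl
      exact ⟨ν, .tau h hν, hD, hG⟩
    · cases h
    · obtain ⟨ν, hν, hD, -⟩ := ih rfl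
      exact ⟨ν, hν, fun P hP => .tau (O.step_own h) (hD P hP), fun X hX => absurd h (hX.1 _)⟩
    · obtain ⟨ν, hν, hD, -⟩ := ih rfl
      have ha X : a ∈ O.back k X := ⟨k', .inl h⟩
      exact ⟨_, .act hE hν, fun P hP => fft_op_of_act
        (fun P P' hs hP => .tau (O.step_sync h hs) (hD P' hP)) hP,
        fun X _ => ⟨fun _ _ => .inr ⟨a, ha X, ν, rfl⟩, fun _ _ _ _ => ⟨a, ha X, ν, rfl⟩⟩⟩
  | refusal hX hs _ ih =>
    subst hE
    obtain ⟨hk, hQ⟩ := O.refuses_op_iff.1 ⟨hs, hX⟩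
    obtain ⟨ν, hν, hD, -⟩ := ih rfl
    exact ⟨_, .refusal hQ.2 hQ.1 hν, fun P => fft_op_cons_of_refuses hk hQ hν
      fun P hX hP => .refusal hX.2 hX.1 (hD P hP), guarded_refusal⟩
  | timeoutRef hX hs ht _ ih =>
    subst hE
    obtain ⟨hk, hQ⟩ := O.refuses_op_iff.1 ⟨hs, hX⟩
    obtain ⟨h, _⟩ | ⟨_, E', h, rfl⟩ | ⟨k', h, rfl⟩ | ⟨a, k', E', h, _⟩ := O.step_iff.1 ht
    · cases h
    · obtain ⟨ν, hν, hD, hG⟩ := ih rfl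
      obtain ⟨ν, rfl⟩ | ⟨a, ha, ν, rfl⟩ := (hG _ hk).1 _ rfl
      · exact ⟨_, .timeoutRef hQ.2 hQ.1 h hν, hD, hG⟩
      · exact ⟨_, .timeoutAct hQ.2 hQ.1 h hν ha, fun P => fft_op_cons_of_timeout hk ha
          fun P P' hX ht hP => .timeoutRef hX.2 hX.1 (O.step_timeout ht) (hD P' hP),
          guarded_refusal⟩
    · obtain ⟨ν, hν, hD, -⟩ := ih rfl
      exact ⟨_, .refusal hQ.2 hQ.1 hν, fun P => fft_op_cons_of_refuses hk hQ hν
        fun P hX hP => .timeoutRef hX.2 hX.1 (O.step_own h) (hD P hP), guarded_refusal⟩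
    · exact absurd h O.not_sync_timeout
  | timeoutAct hX hs ht _ haX ih =>
    subst hE
    obtain ⟨hk, hQ⟩ := O.refuses_op_iff.1 ⟨hs, hX⟩
    obtain ⟨h, _⟩ | ⟨_, E', h, rfl⟩ | ⟨k', h, rfl⟩ | ⟨a, k', E', h, _⟩ := O.step_iff.1 ht
    · cases h
    · obtain ⟨ν, hν, hD, hG⟩ := ih rfl
      obtain ⟨b, hb, ν, rfl⟩ := (hG _ hk).2 _ haX _ rfl
      exact ⟨_, .timeoutAct hQ.2 hQ.1 h hν hb, fun P => fft_op_cons_of_timeout hk hb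
        fun P P' hX ht hP => .timeoutAct hX.2 hX.1 (O.step_timeout ht) (hD P' hP) haX,
        guarded_refusal⟩
    · obtain ⟨ν, hν, hD, -⟩ := ih rfl
      exact ⟨_, .refusal hQ.2 hQ.1 hν, fun P => fft_op_cons_of_refuses hk hQ hν
        fun P hX hP => .timeoutAct hX.2 hX.1 (O.step_own h) (hD P hP) haX, guarded_refusal⟩
    · exact absurd h O.not_sync_timeout

theorem fft_op_mono {k : κ} {P Q : Expr} (h : ∀ {ν}, fft Q ν → fft P ν) {σ : PFT}
    (hσ : fft (O.op k Q) σ) : fft (O.op k P) σ := by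
  obtain ⟨ν, hν, hD, -⟩ := exists_fft hσ
  exact hD P (h hν)

theorem refuses_op_mono {k : κ} {P Q : Expr} {X : Set ℕ} (h : RootedLE Q P)
    (hQ : Refuses (O.op k Q) X) : Refuses (O.op k P) X := by
  obtain ⟨hk, hQ⟩ := O.refuses_op_iff.1 hQ
  exact O.refuses_op_iff.2 ⟨hk, h.refuses hQ⟩

theorem rootedLE_op {k : κ} {P Q : Expr} (h : RootedLE Q P) :
    RootedLE (O.op k Q) (O.op k P) where
  fft := fft_op_mono h.fft
  stable hs := (refuses_op_mono (X := ∅) h ⟨hs, by simp⟩).1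
  timeout {Q' X σ} hX ht hσ := by
    obtain ⟨hk, hQ⟩ := O.refuses_op_iff.1 hX
    obtain ⟨h', _⟩ | ⟨_, E', h', rfl⟩ | ⟨k', h', rfl⟩ | ⟨a, k', E', h', _⟩ := O.step_iff.1 ht
    · cases h'
    · obtain ⟨ν, hν, hD, hG⟩ := exists_fft hσ
      obtain ⟨ν, rfl⟩ | ⟨a, ha, ν, rfl⟩ := (hG _ hk).1 _ rfl
      · obtain ⟨P', hP', hν'⟩ := h.timeout hQ h' hν
        exact ⟨_, O.step_timeout hP', hD _ hν'⟩
      · obtain ⟨P', hP', hν' | hν'⟩ := exists_timeout_of_fft (h.refuses hQ).1 ha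
          (h.fft (.timeoutAct hQ.2 hQ.1 h' hν ha))
        · exact ⟨_, O.step_timeout hP', fft_op_cons_of_timeout hk ha (fun P P' hX ht hP =>
            .timeoutRef hX.2 hX.1 (O.step_timeout ht) (hD P' hP)) hν'⟩
        · exact ⟨_, O.step_timeout hP', hD _ hν'⟩
    · exact ⟨_, O.step_own h', fft_op_mono h.fft hσ⟩
    · exact absurd h' O.not_sync_timeout
  tau := by
    rintro ⟨Q', hs⟩ hσ
    by_contra hst
    obtain ⟨hk, hP⟩ := O.refuses_op_iff.1 (⟨hst, by simp⟩ : Refuses (O.op k P) ∅)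
    have hact {a ν} (ha : a ∈ O.back k ∅) (hν : _root_.fft Q (Sum.inl a :: ν)) : False :=
      hP.not_fft_act ha (h.fft hν)
    obtain ⟨_, E', hE, rfl⟩ | ⟨h', _⟩ | ⟨k', h', rfl⟩ | ⟨a, k', E', h', hE, _⟩ :=
      O.step_iff.1 hs
    · obtain ⟨ν, hν, -, hG⟩ := exists_fft hσ
      obtain ⟨ν, rfl⟩ | ⟨a, ha, ν, rfl⟩ := (hG _ hk).1 _ rfl
      · exact hP.1 (h.tau ⟨_, hE⟩ (fft_empty_of_fft hν))
      · exact hact ha hν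
    · cases h'
    · exact hk.1 _ h'
    · exact hact ⟨k', .inl h'⟩ (.act hE .top)

/-- Parallel composition with the hole on the left. -/
def parL (S : Set ℕ) : StaticOp Expr where
  op R E := .par S E R
  own R β R' := Step R β R' ∧ β.notIn S
  sync R a β R' := β = .act a ∧ ((a ∉ S ∧ R' = R) ∨ (a ∈ S ∧ Step R (.act a) R'))
  not_sync_timeout := by simp
  step_iff := by
    intro R E β F
    constructor
    · intro h
      cases h with
      | @parL _ _ _ _ E' h hn =>
        cases β with
        | tau => exact .inl ⟨rfl, _, h, rfl⟩
        | timeout => exact .inr (.inl ⟨rfl, _, h, rfl⟩)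
        | act a => exact .inr (.inr (.inr ⟨a, _, _, ⟨rfl, .inl ⟨hn a rfl, rfl⟩⟩, h, rfl⟩))
      | parR h hn => exact .inr (.inr (.inl ⟨_, ⟨h, hn⟩, rfl⟩))
      | parSync h hR ha => exact .inr (.inr (.inr ⟨_, _, _, ⟨rfl, .inr ⟨ha, hR⟩⟩, h, rfl⟩))
    · rintro (⟨rfl, E', h, rfl⟩ | ⟨rfl, E', h, rfl⟩ | ⟨R', ⟨h, hn⟩, rfl⟩ |
        ⟨a, R', E', ⟨rfl, ⟨ha, rfl⟩ | ⟨ha, hR⟩⟩, h, rfl⟩)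
      · exact .parL h (by simp [Act.notIn])
      · exact .parL h (by simp [Act.notIn])
      · exact .parR h hn
      · exact .parL h (by simpa [Act.notIn] using ha)
      · exact .parSync h hR ha

/-- Parallel composition with the hole on the right. -/
def parR (S : Set ℕ) : StaticOp Expr where
  op R E := .par S R E
  own R β R' := Step R β R' ∧ β.notIn S
  sync R a β R' := β = .act a ∧ ((a ∉ S ∧ R' = R) ∨ (a ∈ S ∧ Step R (.act a) R'))
  not_sync_timeout := by simp
  step_iff := by
    intro R E β F
    constructor
    · intro h
      cases h with
      | parR h hn =>
        cases β with
        | tau => exact .inl ⟨rfl, _, h, rfl⟩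
        | timeout => exact .inr (.inl ⟨rfl, _, h, rfl⟩)
        | act a => exact .inr (.inr (.inr ⟨a, _, _, ⟨rfl, .inl ⟨hn a rfl, rfl⟩⟩, h, rfl⟩))
      | parL h hn => exact .inr (.inr (.inl ⟨_, ⟨h, hn⟩, rfl⟩))
      | parSync hR h ha => exact .inr (.inr (.inr ⟨_, _, _, ⟨rfl, .inr ⟨ha, hR⟩⟩, h, rfl⟩))
    · rintro (⟨rfl, E', h, rfl⟩ | ⟨rfl, E', h, rfl⟩ | ⟨R', ⟨h, hn⟩, rfl⟩ |
        ⟨a, R', E', ⟨rfl, ⟨ha, rfl⟩ | ⟨ha, hR⟩⟩, h, rfl⟩)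
      · exact .parR h (by simp [Act.notIn])
      · exact .parR h (by simp [Act.notIn])
      · exact .parL h hn
      · exact .parR h (by simpa [Act.notIn] using ha)
      · exact .parSync hR h ha

/-- Abstraction. -/
def abs (I : Set ℕ) : StaticOp Unit where
  op _ E := .abs I E
  own _ _ _ := False
  sync _ a β _ := (a ∉ I ∧ β = .act a) ∨ (a ∈ I ∧ β = .tau)
  not_sync_timeout := by simp
  step_iff := by
    intro _ E β F
    constructor
    · intro h
      cases h with
      | absFree h hn =>
        cases β with
        | tau => exact .inl ⟨rfl, _, h, rfl⟩
        | timeout => exact .inr (.inl ⟨rfl, _, h, rfl⟩)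
        | act a => exact .inr (.inr (.inr ⟨a, (), _, .inl ⟨hn a rfl, rfl⟩, h, rfl⟩))
      | absHide h ha => exact .inr (.inr (.inr ⟨_, (), _, .inr ⟨ha, rfl⟩, h, rfl⟩))
    · rintro (⟨rfl, E', h, rfl⟩ | ⟨rfl, E', h, rfl⟩ | ⟨_, h, _⟩ |
        ⟨a, _, E', ⟨ha, rfl⟩ | ⟨ha, rfl⟩, h, rfl⟩)
      · exact .absFree h (by simp [Act.notIn])
      · exact .absFree h (by simp [Act.notIn])
      · exact h.elim
      · exact .absFree h (by simpa [Act.notIn] using ha)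
      · exact .absHide h ha

/-- Relational renaming. -/
def ren (R : Set (ℕ × ℕ)) : StaticOp Unit where
  op _ E := .ren R E
  own _ _ _ := False
  sync _ a β _ := ∃ b, (a, b) ∈ R ∧ β = .act b
  not_sync_timeout := by simp
  step_iff := by
    intro _ E β F
    constructor
    · intro h
      cases h with
      | renTau h => exact .inl ⟨rfl, _, h, rfl⟩
      | renTimeout h => exact .inr (.inl ⟨rfl, _, h, rfl⟩)
      | renAct h hR => exact .inr (.inr (.inr ⟨_, (), _, ⟨_, hR, rfl⟩, h, rfl⟩))
    · rintro (⟨rfl, E', h, rfl⟩ | ⟨rfl, E', h, rfl⟩ | ⟨_, h, _⟩ |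
        ⟨a, _, E', ⟨b, hR, rfl⟩, h, rfl⟩)
      · exact .renTau h
      · exact .renTimeout h
      · exact h.elim
      · exact .renAct h hR

end StaticOp

/-! ### Prefixing -/

theorem step_pre_iff {α β : Act} {E F : Expr} : Step (.pre α E) β F ↔ β = α ∧ F = E := by
  constructor
  · intro h
    cases h
    exact ⟨rfl, rfl⟩
  · rintro ⟨rfl, rfl⟩
    exact .pre

theorem refuses_pre_iff {α : Act} {E : Expr} {X : Set ℕ} :
    Refuses (.pre α E) X ↔ α ≠ .tau ∧ α.notIn X := by
  simp only [Refuses, stable, initials, step_pre_iff, Act.notIn, Set.mem_ofPred_eq]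
  constructor
  · rintro ⟨h, h'⟩
    exact ⟨fun e => h ⟨E, e.symm, rfl⟩, fun a e ha => h' a ha ⟨E, e.symm, rfl⟩⟩
  · rintro ⟨h, h'⟩
    exact ⟨fun ⟨_, e, _⟩ => h e.symm, fun a ha ⟨_, e, _⟩ => h' a e.symm ha⟩

theorem fft_pre_mono {α : Act} {P Q : Expr} (h : ∀ {σ}, fft Q σ → fft P σ) {σ : PFT}
    (hσ : fft (.pre α Q) σ) : fft (.pre α P) σ := by
  have href {X} (hX : ∀ a ∈ X, a ∉ initials (.pre α Q)) (hs : stable (.pre α Q)) :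
      Refuses (.pre α P) X := refuses_pre_iff.2 (refuses_pre_iff.1 ⟨hs, hX⟩)
  generalize hE : Expr.pre α Q = E at hσ
  induction hσ with
  | top => exact .top
  | act hs hρ _ =>
    subst hE
    obtain ⟨rfl, rfl⟩ := step_pre_iff.1 hs
    exact .act .pre (h hρ)
  | tau hs hρ _ =>
    subst hE
    obtain ⟨rfl, rfl⟩ := step_pre_iff.1 hs
    exact .tau .pre (h hρ)
  | refusal hX hs _ ih =>
    subst hE
    exact .refusal (href hX hs).2 (href hX hs).1 (ih rfl)
  | timeoutRef hX hs ht hρ _ =>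
    subst hE
    have hP := href hX hs
    obtain ⟨rfl, rfl⟩ := step_pre_iff.1 ht
    exact .timeoutRef hP.2 hP.1 .pre (h hρ)
  | timeoutAct hX hs ht hρ ha _ =>
    subst hE
    have hP := href hX hs
    obtain ⟨rfl, rfl⟩ := step_pre_iff.1 ht
    exact .timeoutAct hP.2 hP.1 .pre (h hρ) ha

theorem RootedLE.pre {P Q : Expr} (h : RootedLE Q P) (α : Act) :
    RootedLE (.pre α Q) (.pre α P) where
  fft := fft_pre_mono h.fft
  stable hs := (refuses_pre_iff.2 (refuses_pre_iff.1
    (⟨hs, by simp⟩ : Refuses (.pre α Q) ∅)) : Refuses (.pre α P) ∅).1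
  timeout _ ht hσ := by
    obtain ⟨rfl, rfl⟩ := step_pre_iff.1 ht
    exact ⟨P, .pre, h.fft hσ⟩
  tau := by
    rintro ⟨Q', hs⟩ -
    obtain ⟨rfl, rfl⟩ := step_pre_iff.1 hs
    exact ⟨P, .pre⟩

/-! ### Choice -/

theorem step_choice_iff {E F G : Expr} {α : Act} :
    Step (.choice E F) α G ↔ Step E α G ∨ Step F α G := by
  constructor
  · intro h
    cases h with
    | choiceL h => exact .inl h
    | choiceR h => exact .inr h
  · rintro (h | h)
    · exact .choiceL h
    · exact .choiceR h

theorem refuses_choice_iff {E F : Expr} {X : Set ℕ} :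
    Refuses (.choice E F) X ↔ Refuses E X ∧ Refuses F X := by
  simp only [Refuses, stable, initials, step_choice_iff, Set.mem_ofPred_eq, exists_or, not_or]
  constructor
  · rintro ⟨⟨h, h'⟩, hX⟩
    exact ⟨⟨h, fun a ha => (hX a ha).1⟩, h', fun a ha => (hX a ha).2⟩
  · rintro ⟨⟨h, hX⟩, h', hX'⟩
    exact ⟨⟨h, h'⟩, fun a ha => ⟨hX a ha, hX' a ha⟩⟩

theorem fft_choice_of_unstable {P R : Expr} {σ : PFT} (hP : ¬ stable P) (h : fft P σ) :
    fft (.choice P R) σ := by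
  cases h with
  | top => exact .top
  | act hs hρ => exact .act (.choiceL hs) hρ
  | tau hs hρ => exact .tau (.choiceL hs) hρ
  | refusal _ hs _ => exact absurd hs hP
  | timeoutRef _ hs => exact absurd hs hP
  | timeoutAct _ hs => exact absurd hs hP

theorem fft_choice_of_act {P R : Expr} {a : ℕ} {ρ : PFT} (h : fft P (Sum.inl a :: ρ)) :
    fft (.choice P R) (Sum.inl a :: ρ) := by
  cases h with
  | act hs hρ => exact .act (.choiceL hs) hρ
  | tau hs hρ => exact .tau (.choiceL hs) hρ

theorem RootedLE.exists_timeout_choice {P Q Q' R : Expr} {X : Set ℕ} {σ : PFT}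
    (h : RootedLE Q P) (hX : Refuses (.choice Q R) X) (ht : Step (.choice Q R) .timeout Q')
    (hσ : _root_.fft Q' (Sum.inr X :: σ)) :
    ∃ P', Step (.choice P R) .timeout P' ∧ _root_.fft P' (Sum.inr X :: σ) := by
  obtain ht | ht := step_choice_iff.1 ht
  · obtain ⟨P', hP', hσ'⟩ := h.timeout (refuses_choice_iff.1 hX).1 ht hσ
    exact ⟨P', .choiceL hP', hσ'⟩
  · exact ⟨Q', .choiceR ht, hσ⟩

theorem RootedLE.refuses_choice {P Q R : Expr} {X : Set ℕ} (h : RootedLE Q P)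
    (hX : Refuses (.choice Q R) X) : Refuses (.choice P R) X :=
  refuses_choice_iff.2 ((refuses_choice_iff.1 hX).imp_left h.refuses)

theorem RootedLE.fft_choice {P Q R : Expr} (h : RootedLE Q P) {σ : PFT}
    (hσ : _root_.fft (.choice Q R) σ) : _root_.fft (.choice P R) σ := by
  generalize hE : Expr.choice Q R = E at hσ
  induction hσ with
  | top => exact .top
  | act hs hρ _ =>
    subst hE
    obtain hs | hs := step_choice_iff.1 hs
    · exact fft_choice_of_act (h.fft (.act hs hρ))
    · exact .act (.choiceR hs) hρ
  | @tau _ _ ρ hs hρ _ =>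
    subst hE
    obtain hs | hs := step_choice_iff.1 hs
    · have hP := h.fft (.tau hs hρ)
      match ρ, hρ, hP with
      | [], _, _ => exact .top
      | .inl a :: ρ, _, hP => exact fft_choice_of_act hP
      | .inr X :: ρ, hρ, hP =>
        exact fft_choice_of_unstable
          (not_not.2 (h.tau ⟨_, hs⟩ (fft_empty_of_fft (.tau hs hρ)))) hP
    · exact .tau (.choiceR hs) hρ
  | refusal hX hs _ ih =>
    subst hE
    have hP := h.refuses_choice ⟨hs, hX⟩
    exact .refusal hP.2 hP.1 (ih rfl)
  | timeoutRef hX hs ht hρ _ =>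
    subst hE
    have hP := h.refuses_choice ⟨hs, hX⟩
    obtain ⟨P', hP', hσ⟩ := h.exists_timeout_choice ⟨hs, hX⟩ ht hρ
    exact .timeoutRef hP.2 hP.1 hP' hσ
  | timeoutAct hX hs ht hρ ha _ =>
    subst hE
    have hP := h.refuses_choice ⟨hs, hX⟩
    obtain ht | ht := step_choice_iff.1 ht
    · have hQ := (refuses_choice_iff.1 ⟨hs, hX⟩).1
      obtain ⟨P', hP', hσ | hσ⟩ := exists_timeout_of_fft (h.stable hQ.1) ha
        (h.fft (.timeoutAct hQ.2 hQ.1 ht hρ ha))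
      · exact .timeoutRef hP.2 hP.1 (.choiceL hP') hσ
      · exact .timeoutAct hP.2 hP.1 (.choiceL hP') hσ ha
    · exact .timeoutAct hP.2 hP.1 (.choiceR ht) hρ ha

theorem RootedLE.choiceL {P Q : Expr} (h : RootedLE Q P) (R : Expr) :
    RootedLE (.choice Q R) (.choice P R) where
  fft := h.fft_choice
  stable hs := (h.refuses_choice (X := ∅) ⟨hs, by simp⟩).1
  timeout := h.exists_timeout_choice
  tau := by
    rintro ⟨Q', hs⟩ hσ
    by_cases hR : _root_.stable R
    · have hQ : _root_.fft Q [Sum.inr ∅] := by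
        cases hσ with
        | tau hs hρ =>
          obtain hs | hs := step_choice_iff.1 hs
          · exact .tau hs hρ
          · exact absurd ⟨_, hs⟩ hR
        | refusal _ h _ => exact absurd ⟨_, hs⟩ h
        | timeoutRef _ h => exact absurd ⟨_, hs⟩ h
      obtain hs | hs := step_choice_iff.1 hs
      · obtain ⟨P', hP'⟩ := h.tau ⟨_, hs⟩ hQ
        exact ⟨P', .choiceL hP'⟩
      · exact absurd ⟨_, hs⟩ hR
    · obtain ⟨R', hR'⟩ := not_not.1 hR
      exact ⟨R', .choiceR hR'⟩

theorem fft_of_step_iff {P Q : Expr} (h : ∀ α E, Step Q α E ↔ Step P α E) {σ : PFT}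
    (hσ : fft Q σ) : fft P σ := by
  induction hσ with
  | top => exact .top
  | act hs hρ _ => exact .act ((h _ _).1 hs) hρ
  | tau hs hρ _ => exact .tau ((h _ _).1 hs) hρ
  | refusal hX hs _ ih =>
    simp only [stable, initials, h] at hX hs
    exact .refusal hX hs (ih h)
  | timeoutRef hX hs ht hρ _ =>
    simp only [stable, initials, h] at hX hs ht
    exact .timeoutRef hX hs ht hρ
  | timeoutAct hX hs ht hρ ha _ =>
    simp only [stable, initials, h] at hX hs ht
    exact .timeoutAct hX hs ht hρ ha

theorem rfftSet_eq_of_step_iff {P Q : Expr} (h : ∀ α E, Step Q α E ↔ Step P α E) :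
    rfftSet Q = rfftSet P := by
  have hf σ : fft Q σ ↔ fft P σ :=
    ⟨fft_of_step_iff h, fft_of_step_iff fun α E => (h α E).symm⟩
  simp only [rfftSet, stable, initials, h, hf]

theorem rfftSet_choice_comm (E F : Expr) :
    rfftSet (.choice E F) = rfftSet (.choice F E) :=
  rfftSet_eq_of_step_iff fun _ _ => by simp only [step_choice_iff, or_comm]

/-- The rooted partial failure trace preorder is a
precongruence for the operators of CCSP_t: for every unary recursion-free
CCSP_t-context `C`, if `rfft(P) ⊇ rfft(Q)` then `rfft(C[P]) ⊇ rfft(C[Q])`. -/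
theorem rfft_precongruence (P Q : Expr) (hP : IsProcess P) (hQ : IsProcess Q)
    (h : rfftSet Q ⊆ rfftSet P) :
    ∀ C : Ctx, Ctx.OK C → rfftSet (C.fill Q) ⊆ rfftSet (C.fill P) := by
  intro C hC
  induction hC with
  | hole => exact h
  | @pre α C _ ih => exact rfftSet_subset_iff.2 ((rfftSet_subset_iff.1 ih).pre α)
  | @choiceL C R _ _ ih => exact rfftSet_subset_iff.2 ((rfftSet_subset_iff.1 ih).choiceL R)
  | @choiceR R C _ _ ih =>
    simp only [Ctx.fill, rfftSet_choice_comm R]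
    exact rfftSet_subset_iff.2 ((rfftSet_subset_iff.1 ih).choiceL R)
  | @parL S C R _ _ ih =>
    exact rfftSet_subset_iff.2
      (StaticOp.rootedLE_op (O := .parL S) (k := R) (rfftSet_subset_iff.1 ih))
  | @parR S R C _ _ ih =>
    exact rfftSet_subset_iff.2
      (StaticOp.rootedLE_op (O := .parR S) (k := R) (rfftSet_subset_iff.1 ih))
  | @abs I C _ ih =>
    exact rfftSet_subset_iff.2
      (StaticOp.rootedLE_op (O := .abs I) (k := ()) (rfftSet_subset_iff.1 ih))
  | @ren R C _ _ ih =>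
    exact rfftSet_subset_iff.2
      (StaticOp.rootedLE_op (O := .ren R) (k := ()) (rfftSet_subset_iff.1 ih))
end
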